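/- Let Q = [0,l]² with l > 0, let u be a C² function on Q, and let x⁰ = (x₀,y₀) ∈ Q. Then ∫_Q (u(x) − u(x⁰))² dx ≤ 4 l² ∫_Q (|∂₁u|² + |∂₂u|²) dx + 2 l⁴ ∫_Q (∂₁∂₂u)² dx. -/

import Mathlib

open MeasureTheory Real

/-- First partial derivative of a function on `ℝ²`. -/
noncomputable def pd1 (f : ℝ × ℝ → ℝ) (p : ℝ × ℝ) : ℝ :=
  deriv (fun s => f (s, p.2)) p.1

/-- Second partial derivative of a function on `ℝ²`. -/
noncomputable def pd2 (f : ℝ × ℝ → ℝ) (p : ℝ × ℝ) : ℝ :=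
  deriv (fun s => f (p.1, s)) p.2

/-- If a function of `n + 1` derivatives is differentiated in the first variable, `n` remain. -/
theorem contDiff_pd1 {n : ℕ} {f : ℝ × ℝ → ℝ} (hf : ContDiff ℝ (n + 1) f) :
    ContDiff ℝ n (pd1 f) := by
  have h : pd1 f = fun p => fderiv ℝ f p (1, 0) := by
    funext p
    have hd : HasFDerivAt f (fderiv ℝ f p) (p.1, p.2) :=
      (hf.differentiable (by simp) p).hasFDerivAt
    exact (hd.comp_hasDerivAt p.1 ((hasDerivAt_id p.1).prodMk (hasDerivAt_const p.1 p.2))).deriv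
  rw [h]
  exact (hf.fderiv_right le_rfl).clm_apply contDiff_const

theorem contDiff_pd2 {n : ℕ} {f : ℝ × ℝ → ℝ} (hf : ContDiff ℝ (n + 1) f) :
    ContDiff ℝ n (pd2 f) := by
  have h : pd2 f = fun p => fderiv ℝ f p (0, 1) := by
    funext p
    have hd : HasFDerivAt f (fderiv ℝ f p) (p.1, p.2) :=
      (hf.differentiable (by simp) p).hasFDerivAt
    exact (hd.comp_hasDerivAt p.2 ((hasDerivAt_const p.2 p.1).prodMk (hasDerivAt_id p.2))).deriv
  rw [h]
  exact (hf.fderiv_right le_rfl).clm_apply contDiff_const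

theorem integral_pd1 {f : ℝ × ℝ → ℝ} (hf : ContDiff ℝ 1 f) (a b y : ℝ) :
    ∫ s in a..b, pd1 f (s, y) = f (b, y) - f (a, y) := by
  have hd : Differentiable ℝ fun s => f (s, y) := by
    have := hf.differentiable one_ne_zero
    fun_prop
  have hc : Continuous (pd1 f) := (contDiff_pd1 (n := 0) (by simpa using hf)).continuous
  exact intervalIntegral.integral_deriv_eq_sub (fun s _ => hd s)
    (Continuous.intervalIntegrable (by fun_prop : Continuous fun s => pd1 f (s, y)) a b)

theorem integral_pd2 {f : ℝ × ℝ → ℝ} (hf : ContDiff ℝ 1 f) (x a b : ℝ) :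
    ∫ t in a..b, pd2 f (x, t) = f (x, b) - f (x, a) := by
  have hd : Differentiable ℝ fun t => f (x, t) := by
    have := hf.differentiable one_ne_zero
    fun_prop
  have hc : Continuous (pd2 f) := (contDiff_pd2 (n := 0) (by simpa using hf)).continuous
  exact intervalIntegral.integral_deriv_eq_sub (fun s _ => hd s)
    (Continuous.intervalIntegrable (by fun_prop : Continuous fun t => pd2 f (x, t)) a b)

/-- Cauchy-Schwarz for a continuous function on a subinterval of `[0, l]`. -/
theorem sq_intervalIntegral_le {l a b : ℝ} (hl : 0 < l) (ha : a ∈ Set.Icc 0 l)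
    (hb : b ∈ Set.Icc 0 l) {f : ℝ → ℝ} (hf : Continuous f) :
    (∫ s in a..b, f s) ^ 2 ≤ l * ∫ s in (0 : ℝ)..l, f s ^ 2 := by
  wlog hab : a ≤ b generalizing a b
  · rw [intervalIntegral.integral_symm, neg_sq]
    exact this hb ha (le_of_not_ge hab)
  set I := ∫ s in a..b, f s with hI
  have hmono : ∫ s in a..b, f s ^ 2 ≤ ∫ s in (0 : ℝ)..l, f s ^ 2 :=
    intervalIntegral.integral_mono_interval ha.1 hab hb.2
      (Filter.Eventually.of_forall fun s => sq_nonneg (f s))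
      ((hf.pow 2).intervalIntegrable 0 l)
  have hnonneg : 0 ≤ ∫ s in a..b, (l * f s - I) ^ 2 :=
    intervalIntegral.integral_nonneg hab fun s _ => sq_nonneg _
  have hexpand : ∫ s in a..b, (l * f s - I) ^ 2 =
      l ^ 2 * (∫ s in a..b, f s ^ 2) - 2 * l * I * I + (b - a) * I ^ 2 := by
    have h : ∀ s, (l * f s - I) ^ 2 = l ^ 2 * f s ^ 2 - 2 * l * I * f s + I ^ 2 := fun s => by ring
    simp_rw [h]
    rw [intervalIntegral.integral_add, intervalIntegral.integral_sub,
      intervalIntegral.integral_const_mul, intervalIntegral.integral_const_mul,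
      intervalIntegral.integral_const, smul_eq_mul]
    all_goals exact Continuous.intervalIntegrable (by fun_prop) _ _
  have hlen : (b - a) * I ^ 2 ≤ l * I ^ 2 :=
    mul_le_mul_of_nonneg_right (by linarith [ha.1, hb.2]) (sq_nonneg I)
  have hsq : l * I ^ 2 ≤ l * (l * ∫ s in a..b, f s ^ 2) := by nlinarith
  exact (le_of_mul_le_mul_left hsq hl).trans (mul_le_mul_of_nonneg_left hmono hl.le)

theorem continuous_integral_fst {g : ℝ × ℝ → ℝ} (hg : Continuous g) (a b : ℝ) :
    Continuous fun y => ∫ s in a..b, g (s, y) :=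
  intervalIntegral.continuous_parametric_intervalIntegral_of_continuous'
    (f := fun y s => g (s, y)) (hg.comp continuous_swap) a b

theorem continuous_integral_snd {g : ℝ × ℝ → ℝ} (hg : Continuous g) (a b : ℝ) :
    Continuous fun x => ∫ t in a..b, g (x, t) :=
  intervalIntegral.continuous_parametric_intervalIntegral_of_continuous'
    (f := fun x t => g (x, t)) hg a b

theorem integrableOn_square {g : ℝ × ℝ → ℝ} (hg : Continuous g) (l : ℝ) :
    IntegrableOn g (Set.Icc 0 l ×ˢ Set.Icc 0 l) :=
  hg.continuousOn.integrableOn_compact (isCompact_Icc.prod isCompact_Icc)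

theorem setIntegral_square {l : ℝ} (hl : 0 ≤ l) {g : ℝ × ℝ → ℝ} (hg : Continuous g) :
    ∫ p in Set.Icc 0 l ×ˢ Set.Icc 0 l, g p = ∫ x in (0 : ℝ)..l, ∫ y in (0 : ℝ)..l, g (x, y) := by
  have h := integrableOn_square hg l
  rw [Measure.volume_eq_prod] at h ⊢
  rw [setIntegral_prod _ h]
  simp_rw [integral_Icc_eq_integral_Ioc, ← intervalIntegral.integral_of_le hl]

theorem setIntegral_square_symm {l : ℝ} (hl : 0 ≤ l) {g : ℝ × ℝ → ℝ} (hg : Continuous g) :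
    ∫ p in Set.Icc 0 l ×ˢ Set.Icc 0 l, g p = ∫ y in (0 : ℝ)..l, ∫ x in (0 : ℝ)..l, g (x, y) := by
  refine Eq.trans ?_ (setIntegral_square hl (g := fun p => g p.swap) (hg.comp continuous_swap))
  rw [Measure.volume_eq_prod, setIntegral_prod_swap]

/-- The deviation is the sum of two one-dimensional increments and a mixed double increment. -/
theorem sq_deviation_le {l : ℝ} (hl : 0 < l) {u : ℝ × ℝ → ℝ} (hu : ContDiff ℝ 2 u)
    {x0 p : ℝ × ℝ} (hx0 : x0 ∈ Set.Icc (0 : ℝ) l ×ˢ Set.Icc (0 : ℝ) l)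
    (hp : p ∈ Set.Icc (0 : ℝ) l ×ˢ Set.Icc (0 : ℝ) l) :
    (u p - u x0) ^ 2 ≤ 4 * l * (∫ s in (0 : ℝ)..l, pd1 u (s, p.2) ^ 2) +
      4 * l * (∫ t in (0 : ℝ)..l, pd2 u (p.1, t) ^ 2) +
      2 * l ^ 2 * ∫ q in Set.Icc (0 : ℝ) l ×ˢ Set.Icc (0 : ℝ) l, pd1 (pd2 u) q ^ 2 := by
  obtain ⟨x, y⟩ := p
  obtain ⟨a, b⟩ := x0
  obtain ⟨hx, hy⟩ := hp
  obtain ⟨ha, hb⟩ := hx0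
  dsimp only at hx hy ha hb ⊢
  have hu1 : ContDiff ℝ 1 u := hu.of_le one_le_two
  have hv : ContDiff ℝ 1 (pd2 u) := contDiff_pd2 (n := 1) (by simpa [one_add_one_eq_two] using hu)
  have c1 : Continuous (pd1 u) := (contDiff_pd1 (n := 0) (by simpa using hu1)).continuous
  have cw : Continuous (pd1 (pd2 u)) := (contDiff_pd1 (n := 0) (by simpa using hv)).continuous
  have c2 : Continuous (pd2 u) := hv.continuous
  have cw2 : Continuous fun q => pd1 (pd2 u) q ^ 2 := cw.pow 2
  have hA := sq_intervalIntegral_le hl ha hx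
    (by fun_prop : Continuous fun s => pd1 u (s, y))
  have hB := sq_intervalIntegral_le hl hb hy
    (by fun_prop : Continuous fun t => pd2 u (x, t))
  have hC := sq_intervalIntegral_le hl hb hy (continuous_integral_fst cw a x)
  have hC' : ∫ t in (0 : ℝ)..l, (∫ s in a..x, pd1 (pd2 u) (s, t)) ^ 2 ≤
      l * ∫ q in Set.Icc (0 : ℝ) l ×ˢ Set.Icc (0 : ℝ) l, pd1 (pd2 u) q ^ 2 := by
    rw [setIntegral_square_symm hl.le cw2, ← intervalIntegral.integral_const_mul]
    refine intervalIntegral.integral_mono hl.le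
      (((continuous_integral_fst cw a x).pow 2).intervalIntegrable _ _)
      (((continuous_integral_fst cw2 0 l).const_mul l).intervalIntegrable _ _) fun t => ?_
    exact sq_intervalIntegral_le hl ha hx (by fun_prop)
  have hCeq : ∫ t in b..y, ∫ s in a..x, pd1 (pd2 u) (s, t) =
      (u (x, y) - u (x, b)) - (u (a, y) - u (a, b)) := by
    simp_rw [integral_pd1 hv]
    rw [intervalIntegral.integral_sub, integral_pd2 hu1, integral_pd2 hu1]
    all_goals exact Continuous.intervalIntegrable (by fun_prop) _ _
  rw [integral_pd1 hu1] at hA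
  rw [integral_pd2 hu1] at hB
  rw [hCeq] at hC
  have hC'' := hC.trans (mul_le_mul_of_nonneg_left hC' hl.le)
  set A := u (x, y) - u (a, y) with hAdef
  set B := u (x, y) - u (x, b) with hBdef
  set C := B - (u (a, y) - u (a, b)) with hCdef
  have hdev : u (x, y) - u (a, b) = A + B - C := by rw [hCdef, hAdef]; ring
  rw [hdev]
  have hweighted : (A + B - C) ^ 2 ≤ 4 * A ^ 2 + 4 * B ^ 2 + 2 * C ^ 2 := by
    nlinarith [sq_nonneg (A - B), sq_nonneg (2 * A + C), sq_nonneg (2 * B + C)]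
  linarith

/-- Pointwise deviation estimate on a square `Q = [0,l]²`: for a `C²` function `u`
and any `x⁰ ∈ Q`,
`∫_Q (u − u(x⁰))² ≤ 4 l² ∫_Q |∇u|² + 2 l⁴ ∫_Q (∂₁∂₂u)²`. -/
theorem square_deviation_estimate
    (l : ℝ) (hl : 0 < l)
    (u : ℝ × ℝ → ℝ) (hu : ContDiff ℝ 2 u)
    (x0 : ℝ × ℝ) (hx0 : x0 ∈ Set.Icc (0 : ℝ) l ×ˢ Set.Icc (0 : ℝ) l) :
    (∫ p in Set.Icc (0 : ℝ) l ×ˢ Set.Icc (0 : ℝ) l, (u p - u x0) ^ 2) ≤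
      4 * l ^ 2 * (∫ p in Set.Icc (0 : ℝ) l ×ˢ Set.Icc (0 : ℝ) l,
          ((pd1 u p) ^ 2 + (pd2 u p) ^ 2)) +
      2 * l ^ 4 * ∫ p in Set.Icc (0 : ℝ) l ×ˢ Set.Icc (0 : ℝ) l,
          (pd1 (pd2 u) p) ^ 2 := by
  have hu1 : ContDiff ℝ 1 u := hu.of_le one_le_two
  have c1 : Continuous (pd1 u) := (contDiff_pd1 (n := 0) (by simpa using hu1)).continuous
  have c2 : Continuous (pd2 u) := (contDiff_pd2 (n := 0) (by simpa using hu1)).continuous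
  have c1sq : Continuous fun p => pd1 u p ^ 2 := c1.pow 2
  have c2sq : Continuous fun p => pd2 u p ^ 2 := c2.pow 2
  have cu : Continuous u := hu.continuous
  set W := ∫ p in Set.Icc (0 : ℝ) l ×ˢ Set.Icc (0 : ℝ) l, (pd1 (pd2 u) p) ^ 2 with hW
  have cF : Continuous fun p : ℝ × ℝ => 4 * l * ∫ s in (0 : ℝ)..l, pd1 u (s, p.2) ^ 2 :=
    ((continuous_integral_fst c1sq 0 l).comp continuous_snd).const_mul _
  have cG : Continuous fun p : ℝ × ℝ => 4 * l * ∫ t in (0 : ℝ)..l, pd2 u (p.1, t) ^ 2 :=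
    ((continuous_integral_snd c2sq 0 l).comp continuous_fst).const_mul _
  have cK : Continuous fun _ : ℝ × ℝ => 2 * l ^ 2 * W := continuous_const
  refine (setIntegral_mono_on (integrableOn_square (by fun_prop) l)
    (integrableOn_square ((cF.add cG).add cK) l) (measurableSet_Icc.prod measurableSet_Icc)
    fun p hp => sq_deviation_le hl hu hx0 hp).trans_eq ?_
  rw [integral_add' (integrableOn_square (cF.add cG) l) (integrableOn_square cK l),
    integral_add' (integrableOn_square cF l) (integrableOn_square cG l),
    integral_add (integrableOn_square c1sq l) (integrableOn_square c2sq l),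
    setIntegral_square hl.le cF, setIntegral_square hl.le cG, setIntegral_square hl.le cK,
    setIntegral_square_symm hl.le c1sq, setIntegral_square hl.le c2sq]
  simp only [intervalIntegral.integral_const_mul, intervalIntegral.integral_const, smul_eq_mul,
    sub_zero]
  ring
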